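/- arXiv:2202.00301 — 2 statements merged into one kernel-verified Lean document; each statement's English description precedes it below -/
import Mathlib

section
/- Let W be a 6-dimensional complex vector space and let l ⊂ ℙ(∧³W) be a projective line all of whose points are classes of decomposable-into-(vector ∧ 2-form) tensors, i.e., every point of l lies in Ω = {[v ∧ α] : v ∈ W, α ∈ ∧²W}, l is disjoint from the Grassmannian G(3,W) of totally decomposable 3-vectors, and the assignments [v∧α] ↦ [v] ∈ ℙ(W) and [v∧α] ↦ [v∧α∧α] ∈ ℙ(∧⁵W) ≅ ℙ(W*) both map l to lines (are injective linear on l). Then there exist linearly independent v₁, v₂ ∈ W and a 2-form α ∈ ∧²W of maximal rank 6 such that l = {[(λ₁v₁ + λ₂v₂) ∧ α] : (λ₁:λ₂) ∈ ℙ¹}. -/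
open ExteriorAlgebra Module

namespace ExteriorAlgebra

open CliffordAlgebra

variable {K W : Type*} [Field K] [AddCommGroup W] [Module K W]

lemma ι_mul_ι_mul_self (v : W) (x : ExteriorAlgebra K W) : ι K v * (ι K v * x) = 0 := by
  rw [← mul_assoc, ι_sq_zero, zero_mul]

lemma ι_mul_ι_swap (v w : W) : ι K v * ι K w = -(ι K w * ι K v) :=
  eq_neg_of_add_eq_zero_left (ι_add_mul_swap v w)

lemma ι_mul_ι_mul_swap (v w : W) (x : ExteriorAlgebra K W) :
    ι K v * (ι K w * x) = -(ι K w * (ι K v * x)) := by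
  rw [← mul_assoc, ι_mul_ι_swap, neg_mul, mul_assoc]

/-- Contraction with a functional is an antiderivation. -/
lemma contractLeft_ι_mul' (f : Dual K W) (v : W) (x : ExteriorAlgebra K W) :
    contractLeft f (ι K v * x) = f v • x - ι K v * contractLeft f x :=
  contractLeft_ι_mul f v x

lemma contractLeft_ι' (f : Dual K W) (v : W) :
    contractLeft f (ι K v) = algebraMap K (ExteriorAlgebra K W) (f v) :=
  contractLeft_ι _ f v

@[elab_as_elim]
lemma exteriorPower_two_induction {p : ExteriorAlgebra K W → Prop} {α : ExteriorAlgebra K W}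
    (hα : α ∈ ⋀[K]^2 W) (hmul : ∀ u v : W, p (ι K u * ι K v))
    (hadd : ∀ x y, p x → p y → p (x + y)) : p α := by
  have h : α ∈ LinearMap.range (ι K : W →ₗ[K] _) * LinearMap.range (ι K : W →ₗ[K] _) := by
    rw [← pow_two]; exact hα
  refine Submodule.mul_induction_on h ?_ hadd
  rintro _ ⟨u, rfl⟩ _ ⟨v, rfl⟩
  exact hmul u v

lemma ι_mul_ι_mem (u v : W) : ι K u * ι K v ∈ ⋀[K]^2 W := by
  change _ ∈ LinearMap.range (ι K : W →ₗ[K] _) ^ 2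
  rw [pow_two]
  exact Submodule.mul_mem_mul ⟨u, rfl⟩ ⟨v, rfl⟩

/-- Forms of degree two commute with vectors. -/
lemma ι_mul_comm_of_mem {α : ExteriorAlgebra K W} (hα : α ∈ ⋀[K]^2 W) (w : W) :
    ι K w * α = α * ι K w := by
  refine exteriorPower_two_induction hα (fun u v => ?_) (fun x y hx hy => ?_)
  · rw [ι_mul_ι_mul_swap, mul_assoc, ι_mul_ι_swap w v, mul_neg, neg_neg]
  · rw [mul_add, add_mul, hx, hy]

lemma contractLeft_mem_range {α : ExteriorAlgebra K W} (hα : α ∈ ⋀[K]^2 W) (f : Dual K W) :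
    ∃ p : W, contractLeft f α = ι K p := by
  refine exteriorPower_two_induction hα (fun u v => ?_) (fun x y hx hy => ?_)
  · refine ⟨f u • v - f v • u, ?_⟩
    rw [contractLeft_ι_mul', contractLeft_ι', ← Algebra.commutes, ← Algebra.smul_def]
    simp
  · obtain ⟨p, hp⟩ := hx
    obtain ⟨q, hq⟩ := hy
    exact ⟨p + q, by rw [map_add, map_add, hp, hq]⟩

lemma contractLeft_mul_of_mem {α : ExteriorAlgebra K W} (hα : α ∈ ⋀[K]^2 W) (f : Dual K W)
    (y : ExteriorAlgebra K W) :
    contractLeft f (α * y) = contractLeft f α * y + α * contractLeft f y := by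
  refine exteriorPower_two_induction hα (fun u v => ?_) (fun x z hx hz => ?_)
  · rw [mul_assoc, contractLeft_ι_mul', contractLeft_ι_mul', contractLeft_ι_mul', contractLeft_ι',
      ← Algebra.commutes, ← Algebra.smul_def]
    simp only [mul_sub, sub_mul, smul_mul_assoc, mul_smul_comm, mul_assoc]
    abel
  · rw [add_mul, map_add, map_add, hx, hz]; simp only [add_mul]; abel

lemma contractLeft_cube {α : ExteriorAlgebra K W} (hα : α ∈ ⋀[K]^2 W) (f : Dual K W) :
    contractLeft f (α * (α * α)) = (3 : K) • (contractLeft f α * (α * α)) := by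
  obtain ⟨p, hp⟩ := contractLeft_mem_range hα f
  have hc : α * (ι K p * α) = ι K p * (α * α) := by
    rw [← mul_assoc, ← ι_mul_comm_of_mem hα, mul_assoc]
  have hc' : α * (α * ι K p) = ι K p * (α * α) := by
    rw [← ι_mul_comm_of_mem hα, hc]
  rw [contractLeft_mul_of_mem hα, contractLeft_mul_of_mem hα, hp, mul_add, hc, hc']
  module

lemma exists_dual_pair {v₁ v₂ : W} (h : LinearIndependent K ![v₁, v₂]) :
    ∃ f g : Dual K W, f v₁ = 1 ∧ f v₂ = 0 ∧ g v₂ = 1 := by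
  obtain ⟨f, hf⟩ := LinearMap.exists_extend ((Basis.span h).coord 0)
  obtain ⟨g, hg⟩ := LinearMap.exists_extend ((Basis.span h).coord 1)
  have key (i : Fin 2) : (Submodule.span K (Set.range ![v₁, v₂])).subtype (Basis.span h i) =
      ![v₁, v₂] i := by simp [Basis.span_apply]
  have hf' (i : Fin 2) : f (![v₁, v₂] i) = if i = 0 then 1 else 0 := by
    rw [← key, ← LinearMap.comp_apply, hf, Basis.coord_apply, Basis.repr_self_apply]
  have hg' (i : Fin 2) : g (![v₁, v₂] i) = if i = 1 then 1 else 0 := by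
    rw [← key, ← LinearMap.comp_apply, hg, Basis.coord_apply, Basis.repr_self_apply]
  exact ⟨f, g, by simpa using hf' 0, by simpa using hf' 1, by simpa using hg' 1⟩

/-- A 2-form killed by `v₁ ∧ v₂` lies in the ideal generated by `v₁` and `v₂`. -/
lemma exists_eq_of_ι_mul_ι_mul_eq_zero {v₁ v₂ : W} (h : LinearIndependent K ![v₁, v₂])
    {γ : ExteriorAlgebra K W} (hγ : γ ∈ ⋀[K]^2 W) (h0 : ι K v₁ * (ι K v₂ * γ) = 0) :
    ∃ p q : W, γ = ι K v₁ * ι K p + ι K v₂ * ι K q := by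
  obtain ⟨f, g, hf₁, hf₂, hg⟩ := exists_dual_pair h
  obtain ⟨p, hp⟩ := contractLeft_mem_range hγ f
  have h1 : ι K v₂ * (γ - ι K v₁ * ι K p) = 0 := by
    have := congrArg (contractLeft f) h0
    rw [contractLeft_ι_mul', contractLeft_ι_mul', hf₁, hf₂, hp, map_zero, one_smul, zero_smul,
      zero_sub, mul_neg, sub_neg_eq_add] at this
    rw [mul_sub, ι_mul_ι_mul_swap v₂ v₁, sub_neg_eq_add, this]
  obtain ⟨q, hq⟩ := contractLeft_mem_range (Submodule.sub_mem _ hγ (ι_mul_ι_mem v₁ p)) g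
  have h2 := congrArg (contractLeft g) h1
  rw [contractLeft_ι_mul', hg, hq, one_smul, map_zero, sub_eq_zero, sub_eq_iff_eq_add'] at h2
  exact ⟨p, q, h2⟩

lemma ι_mul_eq_of_ι_mul_ι_mul_eq_zero {v₁ v₂ : W} (h : LinearIndependent K ![v₁, v₂])
    {γ : ExteriorAlgebra K W} (hγ : γ ∈ ⋀[K]^2 W) (h0 : ι K v₁ * (ι K v₂ * γ) = 0) :
    ∃ q : W, ι K v₂ * γ = ι K v₂ * ι K v₁ * ι K q := by
  obtain ⟨p, q, rfl⟩ := exists_eq_of_ι_mul_ι_mul_eq_zero h hγ h0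
  exact ⟨p, by rw [mul_add, ι_mul_ι_mul_self, add_zero, mul_assoc]⟩

/-- If `v₁ ∧ α ∧ α` and `v₂ ∧ α ∧ α` are independent, then `α` has maximal rank or `α ∧ α` is
not killed by `v₁ ∧ v₂`. -/
lemma ι_mul_ι_mul_sq_ne_zero [CharZero K] [FiniteDimensional K W] {v₁ v₂ : W}
    {α : ExteriorAlgebra K W}
    (hα : α ∈ ⋀[K]^2 W)
    (hind : LinearIndependent K ![ι K v₁ * (α * α), ι K v₂ * (α * α)])
    (h3 : α * (α * α) = 0) : ι K v₁ * (ι K v₂ * (α * α)) ≠ 0 := by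
  intro h0
  have hker (f : Dual K W) : contractLeft f α * (α * α) = 0 := by
    have := contractLeft_cube hα f
    rw [h3, map_zero] at this
    exact (smul_eq_zero.mp this.symm).resolve_left (by norm_num)
  let S : Submodule K W := (LinearMap.range (contractLeft.flip α)).comap (ι K)
  have hv₁ : v₁ ∉ S := by
    rintro ⟨f, hf⟩
    refine hind.ne_zero 0 ?_
    have := hker f
    rwa [show contractLeft f α = ι K v₁ from hf] at this
  obtain ⟨f, hf, hfS⟩ := Submodule.exists_le_ker_of_notMem hv₁
  have hfα : contractLeft f α = 0 := by
    obtain ⟨p, hp⟩ := contractLeft_mem_range hα f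
    rw [hp, (Module.forall_dual_apply_eq_zero_iff K p).mp fun g => ?_, map_zero]
    obtain ⟨q, hq⟩ := contractLeft_mem_range hα g
    have hfq : f q = 0 := hfS ⟨g, hq⟩
    have := contractLeft_comm g f (x := α)
    rw [hp, hq, contractLeft_ι', contractLeft_ι', hfq, map_zero, neg_zero] at this
    exact (algebraMap_eq_zero_iff W (g p)).mp this
  have hfαα : contractLeft f (α * α) = 0 := by
    rw [contractLeft_mul_of_mem hα, hfα, zero_mul, mul_zero, add_zero]
  have := congrArg (contractLeft f) h0
  rw [contractLeft_ι_mul', contractLeft_ι_mul', hfαα, mul_zero, sub_zero, map_zero,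
    mul_smul_comm, sub_eq_add_neg, ← neg_smul, add_comm] at this
  exact hf (LinearIndependent.pair_iff.mp hind _ _ this).2

end ExteriorAlgebra

section LineInOmega

variable {K W : Type*} [Field K] [AddCommGroup W] [Module K W]

/-- A subset whose span is a plane contains two independent vectors spanning that plane. -/
lemma exists_pair_of_finrank_span_eq_two {s : Set W} (hs : finrank K (Submodule.span K s) = 2) :
    ∃ v ∈ s, ∃ w ∈ s, LinearIndependent K ![v, w] ∧
      Submodule.span K s = Submodule.span K {v, w} := by
  have hfin : FiniteDimensional K (Submodule.span K s) := .of_finrank_pos (by lia)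
  obtain ⟨v, hv, hv0⟩ : ∃ v ∈ s, v ≠ 0 := by
    by_contra! h
    rw [Submodule.span_eq_bot.mpr h, finrank_bot] at hs
    lia
  obtain ⟨w, hw, hwv⟩ : ∃ w ∈ s, w ∉ Submodule.span K {v} := by
    by_contra! h
    have h1 := Submodule.finrank_mono (Submodule.span_le.mpr h)
    rw [hs, finrank_span_singleton hv0] at h1
    lia
  have hind : LinearIndependent K ![v, w] := by
    rw [LinearIndependent.pair_iff' hv0]
    exact fun a ha => hwv (Submodule.mem_span_singleton.mpr ⟨a, ha⟩)
  refine ⟨v, hv, w, hw, hind, (Submodule.eq_of_le_of_finrank_eq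
    (Submodule.span_mono (Set.insert_subset hv (Set.singleton_subset_iff.mpr hw))) ?_).symm⟩
  have h2 := finrank_span_eq_card hind
  rw [Matrix.range_cons_cons_empty, Fintype.card_fin] at h2
  rw [hs, h2]

/-- A vector `v` with `v ∧ α = w ∧ β`, for an element that is not totally decomposable, is
proportional to `w`. -/
lemma ExteriorAlgebra.exists_eq_smul_of_ι_mul_eq {v w : W} {α β : ExteriorAlgebra K W}
    (hβ : β ∈ ⋀[K]^2 W) (hw : w ≠ 0) (h : ι K w * β = ι K v * α)
    (hdec : ¬ ∃ w₁ w₂ w₃ : W, ι K w * β = ι K w₁ * ι K w₂ * ι K w₃) : ∃ c : K, v = c • w := by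
  by_contra! hc
  have hind : LinearIndependent K ![v, w] := by
    rw [LinearIndependent.pair_symm_iff, LinearIndependent.pair_iff' hw]
    exact fun a ha => hc a ha.symm
  obtain ⟨q, hq⟩ := ι_mul_eq_of_ι_mul_ι_mul_eq_zero hind hβ (by rw [h, ι_mul_ι_mul_self])
  exact hdec ⟨_, _, _, hq⟩

/-- A plane in `⋀³W` of forms `v ∧ α`, none of them totally decomposable, whose vectors `v` span
a plane, has a single common `α`. -/
lemma ExteriorAlgebra.exists_common_two_form (L : Submodule K (ExteriorAlgebra K W))
    (hLrk : finrank K L = 2)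
    (hΩ : ∀ x ∈ L, x ≠ 0 → ∃ v : W, ∃ α ∈ ⋀[K]^2 W, x = ι K v * α)
    (hG : ∀ x ∈ L, x ≠ 0 → ¬ ∃ w₁ w₂ w₃ : W, x = ι K w₁ * ι K w₂ * ι K w₃)
    (hπ : finrank K (Submodule.span K
      {v : W | ∃ x ∈ L, x ≠ 0 ∧ ∃ α ∈ ⋀[K]^2 W, x = ι K v * α ∧ v ≠ 0}) = 2) :
    ∃ (v₁ v₂ : W) (α : ExteriorAlgebra K W), LinearIndependent K ![v₁, v₂] ∧ α ∈ ⋀[K]^2 W ∧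
      L = Submodule.span K {ι K v₁ * α, ι K v₂ * α} := by
  have hfin : FiniteDimensional K L := .of_finrank_pos (two_pos.trans_eq hLrk.symm)
  obtain ⟨v₁, ⟨_, hxL, hx0, α, hα, rfl, hv₁⟩, v₂, ⟨_, hyL, hy0, β, hβ, rfl, hv₂⟩, hind, hspan⟩ :=
    exists_pair_of_finrank_span_eq_two hπ
  have hαβ : LinearIndependent K ![ι K v₁ * α, ι K v₂ * β] := by
    rw [LinearIndependent.pair_iff' hx0]
    intro c hc
    obtain ⟨q, hq⟩ := ι_mul_eq_of_ι_mul_ι_mul_eq_zero hind hβ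
      (by rw [← hc, mul_smul_comm, ι_mul_ι_mul_self, smul_zero])
    exact hG _ hyL hy0 ⟨_, _, _, hq⟩
  have hz0 : ι K v₁ * α + ι K v₂ * β ≠ 0 := fun h =>
    one_ne_zero (LinearIndependent.pair_iff.mp hαβ 1 1 (by rwa [one_smul, one_smul])).1
  obtain ⟨v, γ, hγ, hz⟩ := hΩ _ (L.add_mem hxL hyL) hz0
  have hv0 : v ≠ 0 := by
    rintro rfl
    exact hz0 (by rw [hz, map_zero, zero_mul])
  have hv : v ∈ Submodule.span K {v₁, v₂} :=
    hspan ▸ Submodule.subset_span ⟨_, L.add_mem hxL hyL, hz0, γ, hγ, hz, hv0⟩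
  obtain ⟨a, b, rfl⟩ := Submodule.mem_span_pair.mp hv
  have hrel : ι K v₁ * (ι K v₂ * (a • β - b • α)) = 0 := by
    have h := ι_mul_ι_mul_self (a • v₁ + b • v₂) γ
    rw [← hz] at h
    simp only [map_add, map_smul, add_mul, mul_add, smul_mul_assoc, ι_mul_ι_mul_self,
      smul_zero, zero_add, add_zero] at h
    rw [ι_mul_ι_mul_swap v₂ v₁ α] at h
    simp only [mul_sub, mul_smul_comm]
    rw [← h]
    module
  have ha : a ≠ 0 := by
    rintro rfl
    have hb : b ≠ 0 := by
      rintro rfl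
      exact hv0 (by simp)
    rw [zero_smul, zero_sub, mul_neg, mul_neg, neg_eq_zero, mul_smul_comm, mul_smul_comm,
      smul_eq_zero_iff_right hb, ι_mul_ι_mul_swap, neg_eq_zero] at hrel
    obtain ⟨q, hq⟩ := ι_mul_eq_of_ι_mul_ι_mul_eq_zero
      (LinearIndependent.pair_symm_iff.mp hind) hα hrel
    exact hG _ hxL hx0 ⟨_, _, _, hq⟩
  have hb : b ≠ 0 := by
    rintro rfl
    rw [zero_smul, sub_zero, mul_smul_comm, mul_smul_comm, smul_eq_zero_iff_right ha] at hrel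
    obtain ⟨q, hq⟩ := ι_mul_eq_of_ι_mul_ι_mul_eq_zero hind hβ hrel
    exact hG _ hyL hy0 ⟨_, _, _, hq⟩
  obtain ⟨p, q, hpq⟩ := exists_eq_of_ι_mul_ι_mul_eq_zero hind
    (Submodule.sub_mem _ (Submodule.smul_mem _ a hβ) (Submodule.smul_mem _ b hα)) hrel
  have h₁ : ι K v₁ * (b • α + ι K v₁ * ι K p) = b • (ι K v₁ * α) := by
    rw [mul_add, ι_mul_ι_mul_self, add_zero, mul_smul_comm]
  have h₂ : ι K v₂ * (b • α + ι K v₁ * ι K p) = a • (ι K v₂ * β) := by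
    rw [show b • α + ι K v₁ * ι K p = a • β - ι K v₂ * ι K q by
      rw [sub_eq_iff_eq_add'] at hpq; rw [hpq]; abel, mul_sub, ι_mul_ι_mul_self, sub_zero,
      mul_smul_comm]
  refine ⟨v₁, v₂, b • α + ι K v₁ * ι K p, hind,
    Submodule.add_mem _ (Submodule.smul_mem _ b hα) (ι_mul_ι_mem v₁ p), ?_⟩
  rw [h₁, h₂]
  have hind' : LinearIndependent K ![b • (ι K v₁ * α), a • (ι K v₂ * β)] := by
    rw [LinearIndependent.pair_iff] at hαβ ⊢
    intro s t hst
    rw [smul_smul, smul_smul] at hst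
    exact (hαβ _ _ hst).imp (fun h => (mul_eq_zero.mp h).resolve_right hb)
      (fun h => (mul_eq_zero.mp h).resolve_right ha)
  refine (Submodule.eq_of_le_of_finrank_eq (Submodule.span_le.mpr ?_) ?_).symm
  · exact Set.insert_subset (L.smul_mem b hxL) (Set.singleton_subset_iff.mpr (L.smul_mem a hyL))
  · have h := finrank_span_eq_card hind'
    rw [Matrix.range_cons_cons_empty, Fintype.card_fin] at h
    rw [h, hLrk]

/-- If the forms `x ∧ α'`, for `x = v ∧ α'` in the plane `⟨v₁, v₂⟩ ∧ α`, span a plane, then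
`v₁ ∧ α ∧ α` and `v₂ ∧ α ∧ α` are independent. -/
lemma ExteriorAlgebra.linearIndependent_ι_mul_sq {v₁ v₂ : W} {α : ExteriorAlgebra K W}
    (hα : α ∈ ⋀[K]^2 W)
    (hG : ∀ x ∈ Submodule.span K {ι K v₁ * α, ι K v₂ * α}, x ≠ 0 →
      ¬ ∃ w₁ w₂ w₃ : W, x = ι K w₁ * ι K w₂ * ι K w₃)
    (hπ : finrank K (Submodule.span K
      {y : ExteriorAlgebra K W | ∃ x ∈ Submodule.span K {ι K v₁ * α, ι K v₂ * α}, x ≠ 0 ∧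
        ∃ v : W, ∃ β ∈ ⋀[K]^2 W, x = ι K v * β ∧ y = x * β ∧ y ≠ 0}) = 2) :
    LinearIndependent K ![ι K v₁ * (α * α), ι K v₂ * (α * α)] := by
  rw [linearIndependent_iff_card_le_finrank_span, Fintype.card_fin, Set.finrank,
    Matrix.range_cons_cons_empty]
  have : FiniteDimensional K (Submodule.span K {ι K v₁ * (α * α), ι K v₂ * (α * α)}) :=
    .span_of_finite K (Set.toFinite _)
  refine hπ.ge.trans (Submodule.finrank_mono (Submodule.span_le.mpr ?_))
  rintro _ ⟨x, hx, hx0, v, β, hβ, hxv, rfl, -⟩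
  have hdec := hG x hx hx0
  obtain ⟨a, b, rfl⟩ := Submodule.mem_span_pair.mp hx
  have hxw : a • (ι K v₁ * α) + b • (ι K v₂ * α) = ι K (a • v₁ + b • v₂) * α := by
    simp only [map_add, map_smul, add_mul, smul_mul_assoc]
  rw [hxw] at hxv hx0 hdec ⊢
  have hw : a • v₁ + b • v₂ ≠ 0 := by
    intro h
    exact hx0 (by rw [h, map_zero, zero_mul])
  obtain ⟨c, rfl⟩ := exists_eq_smul_of_ι_mul_eq hα hw hxv hdec
  have hc : c ≠ 0 := by
    rintro rfl
    exact hx0 (by rw [hxv, zero_smul, map_zero, zero_mul])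
  have hβα : ι K (a • v₁ + b • v₂) * β = c⁻¹ • (ι K (a • v₁ + b • v₂) * α) := by
    rw [hxv, map_smul, smul_mul_assoc, inv_smul_smul₀ hc]
  have hy : ι K (a • v₁ + b • v₂) * α * β =
      (c⁻¹ * a) • (ι K v₁ * (α * α)) + (c⁻¹ * b) • (ι K v₂ * (α * α)) := by
    rw [ι_mul_comm_of_mem hα, mul_assoc, hβα, mul_smul_comm, ← mul_assoc,
      ← ι_mul_comm_of_mem hα, mul_assoc]
    simp only [map_add, map_smul, add_mul, smul_mul_assoc, smul_add, smul_smul]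
  rw [hy]
  exact Submodule.mem_span_pair.mpr ⟨_, _, rfl⟩

end LineInOmega

/-- Lemma on the description of lines in `Ω ∖ G(3,W)` projecting to lines via
both fibrations.  A line `l ⊆ ℙ(⋀³W)` (encoded as a 2-dimensional subspace `L` of `⋀³W`) all of
whose points lie in `Ω` and avoid `G(3,W)`, and which projects to lines in `ℙ(W)` (via
`[v∧α] ↦ [v]`) and in `ℙ(⋀⁵W)` (via `[v∧α] ↦ [v∧α∧α]`), is of the form
`{[(λ₁v₁+λ₂v₂)∧α]}` for independent `v₁, v₂` and a 2-form `α` of maximal rank. -/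
theorem line_in_omega_description
    (W : Type) [AddCommGroup W] [Module ℂ W] [FiniteDimensional ℂ W]
    (hdim : finrank ℂ W = 6)
    (L : Submodule ℂ (ExteriorAlgebra ℂ W))
    (hL3 : L ≤ ⋀[ℂ]^3 W) (hLrk : finrank ℂ L = 2)
    -- every point of the line lies in `Ω`
    (hΩ : ∀ x ∈ L, x ≠ 0 → ∃ v : W, ∃ α ∈ ⋀[ℂ]^2 W, x = ExteriorAlgebra.ι ℂ v * α)
    -- the line is disjoint from `G(3,W)`: no nonzero point is totally decomposable
    (hG : ∀ x ∈ L, x ≠ 0 →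
      ¬ ∃ w₁ w₂ w₃ : W, x = ExteriorAlgebra.ι ℂ w₁ * ExteriorAlgebra.ι ℂ w₂ *
        ExteriorAlgebra.ι ℂ w₃)
    -- `π₁ : [v∧α] ↦ [v]` maps the line to a line in `ℙ(W)`
    (hπ₁ : finrank ℂ (Submodule.span ℂ
      {v : W | ∃ x ∈ L, x ≠ 0 ∧ ∃ α ∈ ⋀[ℂ]^2 W, x = ExteriorAlgebra.ι ℂ v * α ∧ v ≠ 0}) = 2)
    -- `π₂ : [v∧α] ↦ [v∧α∧α]` maps the line to a line in `ℙ(⋀⁵W)`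
    (hπ₂ : finrank ℂ (Submodule.span ℂ
      {y : ExteriorAlgebra ℂ W | ∃ x ∈ L, x ≠ 0 ∧ ∃ v : W, ∃ α ∈ ⋀[ℂ]^2 W,
        x = ExteriorAlgebra.ι ℂ v * α ∧ y = x * α ∧ y ≠ 0}) = 2) :
    ∃ (v₁ v₂ : W) (α : ExteriorAlgebra ℂ W),
      LinearIndependent ℂ ![v₁, v₂] ∧ α ∈ ⋀[ℂ]^2 W ∧ α * α * α ≠ 0 ∧
      L = Submodule.span ℂ
        {ExteriorAlgebra.ι ℂ v₁ * α, ExteriorAlgebra.ι ℂ v₂ * α} := by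
  obtain ⟨v₁, v₂, α, hind, hα, rfl⟩ := exists_common_two_form L hLrk hΩ hG hπ₁
  have hsq := linearIndependent_ι_mul_sq hα hG hπ₂
  by_cases h3 : α * (α * α) = 0
  · have hne := ι_mul_ι_mul_sq_ne_zero hα hsq h3
    have hm := ι_mul_ι_mem (K := ℂ) v₁ v₂
    refine ⟨v₁, v₂, α + ι ℂ v₁ * ι ℂ v₂, hind, Submodule.add_mem _ hα hm, ?_, ?_⟩
    · have hmα : α * (ι ℂ v₁ * ι ℂ v₂) = ι ℂ v₁ * ι ℂ v₂ * α := by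
        rw [← mul_assoc, ← ι_mul_comm_of_mem hα, mul_assoc, ← ι_mul_comm_of_mem hα, mul_assoc]
      have hmm : ι ℂ v₁ * ι ℂ v₂ * (ι ℂ v₁ * ι ℂ v₂) = 0 := by
        rw [mul_assoc, ι_mul_ι_swap v₁ v₂, mul_neg, ι_mul_ι_mul_self, neg_zero, mul_zero]
      generalize hmdef : ι ℂ v₁ * ι ℂ v₂ = m at hmα hmm
      have hcube : (α + m) * (α + m) * (α + m) = (3 : ℂ) • (m * (α * α)) := by
        have e : (α + m) * (α + m) = α * α + (2 : ℂ) • (m * α) := by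
          rw [add_mul, mul_add, mul_add, hmm, hmα]
          module
        have e1 : α * (α * m) = m * (α * α) := by
          rw [hmα, ← mul_assoc, hmα, mul_assoc]
        have e2 : m * α * m = 0 := by rw [mul_assoc, hmα, ← mul_assoc, hmm, zero_mul]
        rw [e, add_mul, mul_add, mul_add, mul_assoc α α α, h3, mul_assoc α α m, e1,
          smul_mul_assoc, smul_mul_assoc, e2, mul_assoc m α α]
        module
      rw [hcube, ← hmdef, mul_assoc]
      exact smul_ne_zero (by norm_num) hne
    · rw [mul_add, mul_add, ι_mul_ι_mul_self, ι_mul_ι_mul_swap v₂ v₁, ι_sq_zero, mul_zero,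
        neg_zero, add_zero, add_zero]
  · exact ⟨v₁, v₂, α, hind, hα, by rwa [mul_assoc], rfl⟩
end

section
/- Let V₁, V₂ be finite-dimensional complex vector spaces of the same dimension n, and let Q₁ ⊂ ℙ(V₁), Q₂ ⊂ ℙ(V₂) be smooth quadrics defined by nondegenerate quadratic forms q₁, q₂. Suppose ξ : Sym²V₁ → Sym²V₂ is a linear isomorphism such that for every x ∈ V₁ with q₁(x) = 0 there exists y ∈ V₂ with q₂(y) = 0 and ξ(x·x) = y·y (as elements of Sym²V₂, up to scalar). Then, assuming n ≥ 3, there exists a linear map φ : V₁ → V₂ with φ(Q₁) = Q₂ and such that Sym²φ agrees with ξ on the span of squares of elements of Q₁, up to scalar. -/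
open Module TensorProduct

/-- A symmetric matrix of rank at most one over a factorial domain is a multiple of the square of
a vector. -/
theorem exists_eq_mul_mul_of_rank_one {R ι : Type*} [CommRing R] [IsDomain R]
    [UniqueFactorizationMonoid R] [Fintype ι] (M : ι → ι → R)
    (hM : ∀ i j k l, M i j * M k l = M i k * M j l) :
    ∃ (g : R) (y : ι → R), ∀ i j, M i j = g * (y i * y j) := by
  classical
  by_cases hdiag : ∀ i, M i i = 0
  · refine ⟨0, 0, fun i j => ?_⟩
    have h := hM i j i j
    rw [hdiag i, zero_mul] at h
    simpa using h
  push Not at hdiag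
  obtain ⟨i, hi⟩ := hdiag
  let _ : StrongNormalizedGCDMonoid R := Classical.choice (by
    let _ := UniqueFactorizationMonoid.strongNormalizationMonoid (α := R)
    exact ⟨UniqueFactorizationMonoid.toStrongNormalizedGCDMonoid R⟩)
  obtain ⟨y, hy, hgcd⟩ := Finset.extract_gcd (s := Finset.univ) (M i) ⟨i, Finset.mem_univ i⟩
  set h := Finset.univ.gcd (M i)
  replace hy : ∀ j, M i j = h * y j := fun j => hy j (Finset.mem_univ j)
  have cancel : ∀ a r : R, (∀ j, a ∣ r * y j) → a ∣ r := fun a r H => by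
    have := Finset.dvd_gcd (s := Finset.univ) fun j _ => H j
    rw [Finset.gcd_mul_left, hgcd, mul_one] at this
    exact dvd_normalize_iff.1 this
  have hh : h ≠ 0 := fun h0 => hi (by rw [hy, h0, zero_mul])
  have hyi : y i ≠ 0 := fun h0 => hi (by rw [hy, h0, mul_zero])
  have key : ∀ j k, y i * M j k = h * (y j * y k) := fun j k => by
    have := hM i i j k
    rw [hy, hy, hy] at this
    exact mul_left_cancel₀ hh (by linear_combination this)
  obtain ⟨g, hg⟩ : y i ∣ h := cancel _ _ fun j => cancel _ _ fun k =>
    ⟨M j k, by rw [key]; ring⟩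
  refine ⟨g, y, fun j k => mul_left_cancel₀ hyi ?_⟩
  rw [key, hg]; ring

theorem MvPolynomial.exists_eq_C_of_eval_ne_zero {k σ : Type*} [Field k] [IsAlgClosed k] [Finite σ]
    (g : MvPolynomial σ k) (hg : ∀ u, eval u g ≠ 0) : ∃ c : k, c ≠ 0 ∧ g = C c := by
  have hempty : zeroLocus k (Ideal.span {g}) = ∅ := by
    rw [zeroLocus_span]
    ext u
    simpa using hg u
  have h := vanishingIdeal_zeroLocus_eq_radical (K := k) (Ideal.span {g})
  rw [hempty, vanishingIdeal_empty, eq_comm, Ideal.radical_eq_top,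
    Ideal.span_singleton_eq_top] at h
  obtain ⟨c, hc, rfl⟩ := (MvPolynomial.isUnit_iff_eq_C_of_isReduced).1 h
  exact ⟨c, hc.ne_zero, rfl⟩

/-- The parametrization `u ↦ (u, 1, ∑ uᵢ²)` of an affine chart of the quadric `∑ uᵢ² = s t`. -/
noncomputable def quadricChart (m : ℕ) : Fin m ⊕ Unit ⊕ Unit → MvPolynomial (Fin m) ℂ :=
  Sum.elim MvPolynomial.X (Sum.elim (fun _ => 1) fun _ => ∑ i, MvPolynomial.X i ^ 2)

theorem isHomogeneous_quadricChart {m : ℕ} (a : Fin m ⊕ Unit ⊕ Unit) :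
    (quadricChart m a).IsHomogeneous
      (Sum.elim (fun _ => 1) (Sum.elim (fun _ => 0) fun _ => 2) a) := by
  rcases a with i | _ | _
  · exact MvPolynomial.isHomogeneous_X _ _
  · exact MvPolynomial.isHomogeneous_one _ _
  · exact MvPolynomial.IsHomogeneous.sum Finset.univ _ 2 fun i _ =>
      MvPolynomial.isHomogeneous_X_pow i 2

/-- A polynomial whose square is a quadratic expression in the coordinates of the chart is a
linear expression in them. -/
theorem exists_eq_sum_quadricChart_of_sq {m : ℕ} (y : MvPolynomial (Fin m) ℂ)
    (α : Fin m ⊕ Unit ⊕ Unit → Fin m ⊕ Unit ⊕ Unit → ℂ)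
    (hy : y * y = ∑ a, ∑ b, MvPolynomial.C (α a b) * (quadricChart m a * quadricChart m b)) :
    ∃ β : Fin m ⊕ Unit ⊕ Unit → ℂ, y = ∑ a, MvPolynomial.C (β a) * quadricChart m a := by
  classical
  open MvPolynomial in
  let d : Fin m ⊕ Unit ⊕ Unit → ℕ := Sum.elim (fun _ => 1) (Sum.elim (fun _ => 0) fun _ => 2)
  have hd : ∀ a, d a ≤ 2 := by rintro (i | _ | _) <;> simp [d]
  have hom : ∀ a b, (C (α a b) * (quadricChart m a * quadricChart m b)).IsHomogeneous
      (d a + d b) := fun a b =>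
    ((isHomogeneous_quadricChart a).mul (isHomogeneous_quadricChart b)).C_mul _
  have hdeg : y.totalDegree ≤ 2 := by
    by_cases h0 : y = 0
    · simp [h0]
    have h4 : (y * y).totalDegree ≤ 4 := by
      rw [hy]
      refine totalDegree_finsetSum_le fun a _ => totalDegree_finsetSum_le fun b _ => ?_
      have := hd a
      have := hd b
      exact (hom a b).totalDegree_le.trans (by omega)
    rw [totalDegree_mul_of_isDomain h0 h0] at h4
    omega
  have hsum : y = homogeneousComponent 0 y + homogeneousComponent 1 y
      + homogeneousComponent 2 y := by
    have hlt : ∀ i ∈ Finset.range 3, i ∉ Finset.range (y.totalDegree + 1) →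
        homogeneousComponent i y = 0 := fun i _ h =>
      homogeneousComponent_eq_zero _ _ (by simpa using h)
    conv_lhs => rw [← sum_homogeneousComponent y]
    rw [Finset.sum_subset (Finset.range_mono (by omega : y.totalDegree + 1 ≤ 3)) hlt]
    simp [Finset.sum_range_succ]
  have hsq : homogeneousComponent 2 y * homogeneousComponent 2 y =
      C (α (.inr (.inr ())) (.inr (.inr ()))) *
        (quadricChart m (.inr (.inr ())) * quadricChart m (.inr (.inr ()))) := by
    have hl : homogeneousComponent 4 (y * y) =
        homogeneousComponent 2 y * homogeneousComponent 2 y := by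
      have hmul : ∀ i j, homogeneousComponent 4
          (homogeneousComponent i y * homogeneousComponent j y) =
          if i + j = 4 then homogeneousComponent i y * homogeneousComponent j y else 0 :=
        fun i j => by
          rw [homogeneousComponent_of_mem ((homogeneousComponent_isHomogeneous i y).mul
            (homogeneousComponent_isHomogeneous j y))]
          simp only [eq_comm]
      conv_lhs => rw [hsum]
      simp only [add_mul, mul_add, map_add, hmul]
      simp
    rw [← hl, hy]
    have hmul : ∀ a b, homogeneousComponent 4
        (C (α a b) * (quadricChart m a * quadricChart m b)) =
        if 4 = d a + d b then C (α a b) * (quadricChart m a * quadricChart m b) else 0 :=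
      fun a b => homogeneousComponent_of_mem (hom a b)
    simp only [map_sum, hmul]
    simp [d]
  obtain ⟨γ, hγ⟩ := IsAlgClosed.exists_pow_nat_eq (α (.inr (.inr ())) (.inr (.inr ())))
    (n := 2) (by norm_num)
  obtain ⟨δ, hδ⟩ : ∃ δ : ℂ, homogeneousComponent 2 y = C δ * quadricChart m (.inr (.inr ())) := by
    rw [← hγ, C_pow] at hsq
    have hsq' : _ = (C γ * quadricChart m (.inr (.inr ()))) *
        (C γ * quadricChart m (.inr (.inr ()))) := hsq.trans (by ring)
    rcases mul_self_eq_mul_self_iff.1 hsq' with h | h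
    · exact ⟨γ, h⟩
    · exact ⟨-γ, by rw [h, C_neg]; ring⟩
  have hlin : homogeneousComponent 1 y ∈ Submodule.span ℂ (Set.range (X : Fin m → _)) := by
    rw [← homogeneousSubmodule_one_eq_span_X]
    exact homogeneousComponent_mem 1 y
  obtain ⟨ε, hε⟩ := (Submodule.mem_span_range_iff_exists_fun ℂ).1 hlin
  refine ⟨Sum.elim ε (Sum.elim (fun _ => coeff 0 y) fun _ => δ), hsum.trans ?_⟩
  rw [hδ, ← hε, homogeneousComponent_zero]
  simp [quadricChart, smul_eq_C_mul]
  ring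

/-- A quadratic map vanishing on an affine chart of the quadric `∑ uᵢ² = s t` is a multiple of the
defining equation. -/
theorem QuadraticMap.exists_eq_smul_of_chart {m : ℕ} (hm : 0 < m) {N : Type*} [AddCommGroup N]
    [Module ℂ N] (p : QuadraticMap ℂ ((Fin m → ℂ) × ℂ × ℂ) N)
    (hp : ∀ u : Fin m → ℂ, p (u, 1, ∑ i, u i ^ 2) = 0) :
    ∃ z : N, ∀ x, p x = (∑ i, x.1 i ^ 2 - x.2.1 * x.2.2) • z := by
  set e : (Fin m → ℂ) × ℂ × ℂ := (0, 1, 0)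
  set f : (Fin m → ℂ) × ℂ × ℂ := (0, 0, 1)
  have expand : ∀ (r s t : ℂ) (w : Fin m → ℂ), p (r • w, s, t) =
      (r * r) • p (w, 0, 0) + (s * s) • p e + (t * t) • p f + (r * s) • polar p (w, 0, 0) e
        + (r * t) • polar p (w, 0, 0) f + (s * t) • polar p e f := fun r s t w => by
    have : ((r • w, s, t) : (Fin m → ℂ) × ℂ × ℂ) = r • (w, 0, 0) + s • e + t • f := by
      simp [e, f]
    rw [this, QuadraticMap.map_add p, QuadraticMap.map_add p, polar_add_left]
    simp only [polar_smul_left, polar_smul_right, QuadraticMap.map_smul]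
    module
  have hr : ∀ (r : ℂ) (w : Fin m → ℂ), p e + r • polar p (w, 0, 0) e
      + (r ^ 2) • (p (w, 0, 0) + (∑ i, w i ^ 2) • polar p e f)
      + (r ^ 3) • ((∑ i, w i ^ 2) • polar p (w, 0, 0) f)
      + (r ^ 4) • (((∑ i, w i ^ 2) ^ 2) • p f) = 0 := fun r w => by
    have h := hp (r • w)
    rw [expand] at h
    simp only [Pi.smul_apply, smul_eq_mul, mul_pow, ← Finset.mul_sum] at h
    rw [← h]
    module
  have coeffs : ∀ a b c d g : N, (∀ r : ℂ, a + r • b + r ^ 2 • c + r ^ 3 • d + r ^ 4 • g = 0) →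
      a = 0 ∧ b = 0 ∧ c = 0 ∧ d = 0 ∧ g = 0 := fun a b c d g h => by
    have h0 := h 0
    have h1 := h 1
    have h2 := h (-1)
    have h3 := h 2
    have h4 := h (-2)
    refine ⟨?_, ?_, ?_, ?_, ?_⟩
    · linear_combination (norm := module) h0
    · linear_combination (norm := module)
        (2/3 : ℂ) • h1 - (2/3 : ℂ) • h2 - (1/12 : ℂ) • h3 + (1/12 : ℂ) • h4
    · linear_combination (norm := module)
        (2/3 : ℂ) • h1 + (2/3 : ℂ) • h2 - (1/24 : ℂ) • h3 - (1/24 : ℂ) • h4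
          - (5/4 : ℂ) • h0
    · linear_combination (norm := module)
        (-1/6 : ℂ) • h1 + (1/6 : ℂ) • h2 + (1/12 : ℂ) • h3 - (1/12 : ℂ) • h4
    · linear_combination (norm := module)
        (-1/6 : ℂ) • h1 - (1/6 : ℂ) • h2 + (1/24 : ℂ) • h3 + (1/24 : ℂ) • h4
          + (1/4 : ℂ) • h0
  have hw := fun w => coeffs _ _ _ _ _ fun r => hr r w
  have he : p e = 0 := (hw 0).1
  have hone : ∀ i, ∑ j, (Pi.single i (1 : ℂ) : Fin m → ℂ) j ^ 2 = 1 := fun i => by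
    simp [Pi.single_apply]
  have hf : p f = 0 := by
    have := (hw (Pi.single ⟨0, hm⟩ 1)).2.2.2.2
    rwa [hone, one_pow, one_smul] at this
  have hwf : ∀ w, polar p (w, 0, 0) f = 0 := fun w => by
    have hlin : (p.polarBilin.flip f) ∘ₗ LinearMap.inl ℂ (Fin m → ℂ) (ℂ × ℂ) = 0 := by
      refine LinearMap.pi_ext' fun i => LinearMap.ext_ring ?_
      have := (hw (Pi.single i 1)).2.2.2.1
      rw [hone, one_smul] at this
      exact this
    exact LinearMap.congr_fun hlin w
  refine ⟨-polar p e f, fun ⟨w, s, t⟩ => ?_⟩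
  have h := expand 1 s t w
  rw [one_smul] at h
  rw [h, he, hf, hwf, (hw w).2.1, eq_neg_of_add_eq_zero_left (hw w).2.2.1]
  module

theorem eq_zero_of_tmul_self_eq_zero {K V : Type*} [Field K] [AddCommGroup V] [Module K V] {x : V}
    (h : x ⊗ₜ[K] x = 0) : x = 0 := by
  refine (Module.forall_dual_apply_eq_zero_iff K x).1 fun f => ?_
  simpa using congrArg (TensorProduct.lid K K ∘ TensorProduct.map f f) h

theorem quadricChart_point {m : ℕ} (u : Fin m → ℂ) :
    ∑ a, MvPolynomial.eval u (quadricChart m a) • ((Pi.basisFun ℂ (Fin m)).prod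
      ((Basis.singleton Unit ℂ).prod (Basis.singleton Unit ℂ))) a = (u, 1, ∑ i, u i ^ 2) := by
  have hu : ∑ i, u i • (Pi.single i 1 : Fin m → ℂ) = u := by
    ext j
    simp [Pi.single_apply]
  simp [quadricChart, Prod.ext_iff, Prod.fst_sum, Prod.snd_sum, hu]

/-- A linear map on tensors sending squares of points of the quadric `∑ uᵢ² = s t` to multiples of
squares, and killing none of them, is on such squares a multiple of the square of a linear map. -/
theorem exists_linearMap_of_standard_quadric {m : ℕ} (hm : 0 < m) {W : Type*} [AddCommGroup W]
    [Module ℂ W] [FiniteDimensional ℂ W]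
    (ξ : ((Fin m → ℂ) × ℂ × ℂ) ⊗[ℂ] ((Fin m → ℂ) × ℂ × ℂ) →ₗ[ℂ] W ⊗[ℂ] W)
    (hinj : Function.Injective ξ)
    (hξ : ∀ x, ∑ i, x.1 i ^ 2 - x.2.1 * x.2.2 = 0 →
      ∃ (y : W) (c : ℂ), ξ (x ⊗ₜ x) = c • (y ⊗ₜ y)) :
    ∃ (φ : (Fin m → ℂ) × ℂ × ℂ →ₗ[ℂ] W) (c : ℂ), c ≠ 0 ∧
      ∀ x, ∑ i, x.1 i ^ 2 - x.2.1 * x.2.2 = 0 → ξ (x ⊗ₜ x) = c • (φ x ⊗ₜ φ x) := by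
  let w := (Pi.basisFun ℂ (Fin m)).prod
      ((Basis.singleton Unit ℂ).prod (Basis.singleton Unit ℂ))
  let b := finBasis ℂ W
  let bb := b.tensorProduct b
  let P : (Fin m → ℂ) → (Fin m → ℂ) × ℂ × ℂ := fun u => (u, 1, ∑ i, u i ^ 2)
  have hP : ∀ u, P u = ∑ a, MvPolynomial.eval u (quadricChart m a) • w a := fun u =>
    (quadricChart_point u).symm
  let M : Fin (finrank ℂ W) → Fin (finrank ℂ W) → MvPolynomial (Fin m) ℂ := fun i j =>
    ∑ a, ∑ b, MvPolynomial.C (bb.repr (ξ (w a ⊗ₜ w b)) (i, j)) *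
      (quadricChart m a * quadricChart m b)
  have hM : ∀ u i j, MvPolynomial.eval u (M i j) = bb.repr (ξ (P u ⊗ₜ P u)) (i, j) :=
    fun u i j => by
      simp only [M, hP, TensorProduct.sum_tmul, TensorProduct.tmul_sum, ← TensorProduct.smul_tmul',
        TensorProduct.tmul_smul, map_sum, map_smul, Finsupp.coe_finsetSum, Finset.sum_apply,
        Finsupp.smul_apply, smul_eq_mul, map_mul, MvPolynomial.eval_C,
        Finset.mul_sum]
      rw [Finset.sum_comm]
      refine Finset.sum_congr rfl fun a _ => Finset.sum_congr rfl fun b _ => ?_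
      ring
  have hsq : ∀ u, ∃ (y : W) (c : ℂ), ξ (P u ⊗ₜ P u) = c • (y ⊗ₜ y) := fun u =>
    hξ _ (by simp [P])
  have hne : ∀ u, ξ (P u ⊗ₜ P u) ≠ 0 := fun u h => by
    have h0 : P u ⊗ₜ[ℂ] P u = 0 := hinj (by rw [h, map_zero])
    simpa [P] using eq_zero_of_tmul_self_eq_zero h0
  obtain ⟨g, y, hgy⟩ := exists_eq_mul_mul_of_rank_one M fun i j k l => by
    refine MvPolynomial.funext fun u => ?_
    obtain ⟨y, c, h⟩ := hsq u
    simp only [map_mul, hM, h]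
    simp only [map_smul, Finsupp.smul_apply, bb, Basis.tensorProduct_repr_tmul_apply, smul_eq_mul]
    ring
  obtain ⟨c, hc, rfl⟩ := MvPolynomial.exists_eq_C_of_eval_ne_zero g fun u hg => by
    refine hne u (bb.repr.map_eq_zero_iff.1 (Finsupp.ext fun ⟨i, j⟩ => ?_))
    rw [← hM, hgy, map_mul, hg, zero_mul]
    rfl
  have hlin : ∀ i, ∃ β : Fin m ⊕ Unit ⊕ Unit → ℂ,
      y i = ∑ a, MvPolynomial.C (β a) * quadricChart m a := fun i => by
    refine exists_eq_sum_quadricChart_of_sq (y i)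
      (fun a b => c⁻¹ * bb.repr (ξ (w a ⊗ₜ w b)) (i, i)) ?_
    simp only [MvPolynomial.C_mul, mul_assoc, ← Finset.mul_sum]
    change _ = _ * M i i
    rw [hgy, ← mul_assoc, ← MvPolynomial.C_mul, inv_mul_cancel₀ hc, MvPolynomial.C_1, one_mul]
  choose β hβ using hlin
  let φ := w.constr ℂ fun a => ∑ i, β i a • b i
  have hφ : ∀ u i, b.repr (φ (P u)) i = MvPolynomial.eval u (y i) := fun u i => by
    simp [hP, φ, hβ, Finsupp.single_apply, mul_comm]
  have hchart : ∀ u, ξ (P u ⊗ₜ P u) = c • (φ (P u) ⊗ₜ φ (P u)) := fun u => by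
    refine bb.repr.injective (Finsupp.ext fun ⟨i, j⟩ => ?_)
    rw [← hM, hgy, map_smul, Finsupp.smul_apply, Basis.tensorProduct_repr_tmul_apply, hφ, hφ]
    simp [mul_comm]
  let B : ((Fin m → ℂ) × ℂ × ℂ) →ₗ[ℂ] ((Fin m → ℂ) × ℂ × ℂ) →ₗ[ℂ] W ⊗[ℂ] W :=
    (TensorProduct.mk ℂ _ _).compr₂ ξ - c • (TensorProduct.mk ℂ W W).compl₁₂ φ φ
  have hB : ∀ x, LinearMap.BilinMap.toQuadraticMap B x =
      ξ (x ⊗ₜ x) - c • (φ x ⊗ₜ φ x) := fun x => rfl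
  obtain ⟨z, hz⟩ := QuadraticMap.exists_eq_smul_of_chart hm
    (LinearMap.BilinMap.toQuadraticMap B) fun u => by rw [hB, sub_eq_zero]; exact hchart u
  refine ⟨φ, c, hc, fun x hx => ?_⟩
  rw [← sub_eq_zero, ← hB, hz, hx, zero_smul]

/-- A nondegenerate complex quadratic form in `m + 2` variables is isometric to
`∑ uᵢ² - s t`. -/
theorem QuadraticForm.exists_linearEquiv_standard {m : ℕ} {V : Type*} [AddCommGroup V]
    [Module ℂ V] [FiniteDimensional ℂ V] (hV : finrank ℂ V = m + 2) (q : QuadraticForm ℂ V)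
    (hq : ∀ x : V, (∀ y : V, QuadraticMap.polar q x y = 0) → x = 0) :
    ∃ E : V ≃ₗ[ℂ] (Fin m → ℂ) × ℂ × ℂ,
      ∀ x, q x = ∑ i, (E x).1 i ^ 2 - (E x).2.1 * (E x).2.2 := by
  have hsep : (QuadraticMap.associated (R := ℂ) q).SeparatingLeft := fun x hx => hq x fun y => by
    have := hx y
    rw [QuadraticMap.associated_apply] at this
    simpa [QuadraticMap.polar] using this
  obtain ⟨e⟩ := QuadraticForm.equivalent_weightedSumSquares_of_isAlgClosed q hsep
  have he : ∀ x, q x = ∑ i, e x i ^ 2 := fun x => by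
    have := e.map_app x
    rw [QuadraticMap.weightedSumSquares_apply] at this
    simpa [sq] using this.symm
  let r : Fin (finrank ℂ V) ≃ Fin (m + 2) := finCongr hV
  let F : (Fin (m + 2) → ℂ) ≃ₗ[ℂ] (Fin m → ℂ) × ℂ × ℂ :=
    { toFun := fun v => (fun i => v i.succ.succ, -(v 0 + Complex.I * v 1), v 0 - Complex.I * v 1)
      invFun := fun x => Fin.cons ((x.2.2 - x.2.1) / 2)
        (Fin.cons (Complex.I * (x.2.1 + x.2.2) / 2) x.1)
      map_add' := fun v v' => by ext <;> simp <;> ring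
      map_smul' := fun a v => by ext <;> simp <;> ring
      left_inv := fun v => by
        ext i
        refine Fin.cases ?_ (fun i => Fin.cases ?_ (fun i => ?_) i) i
        · simp; ring
        · simp
          linear_combination (-v 1) * Complex.I_sq
        · simp
      right_inv := fun x => by
        ext
        · simp
        · simp; linear_combination (-(x.2.1 + x.2.2) / 2) * Complex.I_sq
        · simp; linear_combination (-(x.2.1 + x.2.2) / 2) * Complex.I_sq }
  refine ⟨e.toLinearEquiv ≪≫ₗ LinearEquiv.funCongrLeft ℂ ℂ r.symm ≪≫ₗ F, fun x => ?_⟩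
  rw [he, ← r.symm.sum_comp, Fin.sum_univ_succ, Fin.sum_univ_succ]
  simp [F, LinearEquiv.funCongrLeft]
  linear_combination (e x (r.symm 1)) ^ 2 * Complex.I_sq

/-- A quadratic form vanishing on the zeros of a nondegenerate complex quadratic form in at least
three variables is a multiple of it. -/
theorem QuadraticForm.exists_eq_mul_of_zeros {V : Type*} [AddCommGroup V]
    [Module ℂ V] [FiniteDimensional ℂ V] (hV : 3 ≤ finrank ℂ V) (q : QuadraticForm ℂ V)
    (hq : ∀ x : V, (∀ y : V, QuadraticMap.polar q x y = 0) → x = 0)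
    (p : QuadraticForm ℂ V) (hp : ∀ x, q x = 0 → p x = 0) :
    ∃ c : ℂ, ∀ x, p x = c * q x := by
  obtain ⟨m, hm⟩ := Nat.exists_eq_add_of_le' hV
  obtain ⟨E, hE⟩ := QuadraticForm.exists_linearEquiv_standard (m := m + 1) hm q hq
  obtain ⟨c, hc⟩ := QuadraticMap.exists_eq_smul_of_chart m.succ_pos
    (p.comp E.symm.toLinearMap) fun u => hp _ (by simp [hE])
  refine ⟨c, fun x => ?_⟩
  have := hc (E x)
  rw [← hE] at this
  simpa [mul_comm] using this

/-- A linear map inducing an injective map on squares of isotropic vectors is injective. -/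
theorem QuadraticForm.injective_of_isotropic_squares {V W : Type*} [AddCommGroup V] [Module ℂ V]
    [AddCommGroup W] [Module ℂ W] [FiniteDimensional ℂ V] (hV : 2 ≤ finrank ℂ V)
    (q : QuadraticForm ℂ V)
    (hq : ∀ x : V, (∀ y : V, QuadraticMap.polar q x y = 0) → x = 0)
    (φ : V →ₗ[ℂ] W)
    (hφ : ∀ x y, q x = 0 → q y = 0 → φ x ⊗ₜ[ℂ] φ x = φ y ⊗ₜ[ℂ] φ y → x ⊗ₜ[ℂ] x = y ⊗ₜ[ℂ] y) :
    Function.Injective φ := by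
  refine (injective_iff_map_eq_zero φ).2 fun x hx => by_contra fun hx0 => ?_
  have hqx : q x ≠ 0 := fun h => hx0 <| by
    exact eq_zero_of_tmul_self_eq_zero (by simpa using hφ x 0 h (map_zero q) (by simp [hx]))
  have hself : QuadraticMap.polar q x x = 2 * q x := by simp [QuadraticMap.polar_self]
  have hperp : ∃ z, QuadraticMap.polar q x z = 0 ∧ q z ≠ 0 := by
    by_contra! H
    obtain ⟨z, hz, hz0⟩ : ∃ z ∈ LinearMap.ker (q.polarBilin x), z ≠ 0 := by
      refine (Submodule.ne_bot_iff _).1 fun hbot => ?_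
      have h1 := LinearMap.finrank_range_add_finrank_ker (q.polarBilin x)
      have h2 := Submodule.finrank_le (LinearMap.range (q.polarBilin x))
      rw [hbot, finrank_bot] at h1
      rw [finrank_self] at h2
      omega
    replace hz : QuadraticMap.polar q x z = 0 := hz
    refine hz0 (hq z fun y => ?_)
    let a := QuadraticMap.polar q x y / (2 * q x)
    have hy : QuadraticMap.polar q x (y - a • x) = 0 := by
      rw [QuadraticMap.polar_sub_right, QuadraticMap.polar_smul_right, hself]
      simp only [a, smul_eq_mul]
      field_simp
      ring
    have h1 : QuadraticMap.polar q z (y - a • x) = 0 := by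
      rw [QuadraticMap.polar, H _ hz, H _ hy,
        H _ (by rw [QuadraticMap.polar_add_right, hz, hy, add_zero])]
      simp
    rw [QuadraticMap.polar_sub_right, QuadraticMap.polar_smul_right,
      QuadraticMap.polar_comm q z x, hz] at h1
    simpa using h1
  obtain ⟨z, hxz, hqz⟩ := hperp
  obtain ⟨r, hr⟩ := IsAlgClosed.exists_pow_nat_eq (-q z / q x) (n := 2) (by norm_num)
  have hr0 : r ≠ 0 := by
    rintro rfl
    rw [zero_pow two_ne_zero, eq_comm, div_eq_zero_iff, neg_eq_zero] at hr
    exact hr.elim hqz hqx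
  have hiso : ∀ s : ℂ, s ^ 2 = r ^ 2 → q (s • x + z) = 0 := fun s hs => by
    rw [QuadraticMap.map_add q, QuadraticMap.polar_smul_left, hxz, QuadraticMap.map_smul, ← sq, hs,
      hr, smul_eq_mul, div_mul_cancel₀ _ hqx]
    simp
  have key := hφ _ _ (hiso r rfl) (hiso (-r) (by ring)) (by simp [hx])
  have key' := congrArg (TensorProduct.lid ℂ ℂ ∘
    TensorProduct.map (q.polarBilin x) (q.polarBilin z)) key
  simp [QuadraticMap.polar_comm q z x, hxz, hself, QuadraticMap.polar_self] at key'
  have h0 : r * (q x * q z) = 0 := by linear_combination key' / 8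
  exact mul_ne_zero hr0 (mul_ne_zero hqx hqz) h0

/-- If a linear isomorphism `ξ` between the (symmetric) squares of two
`n`-dimensional spaces (`n ≥ 3`) maps squares of isotropic vectors of a nondegenerate quadratic
form `q₁` to squares of isotropic vectors of `q₂` (up to scalar), then it is induced, on the span
of such squares and up to scalar, by a linear map `φ` carrying the quadric `Q₁` onto `Q₂`.
(Symmetric squares are modelled inside the tensor square, `x·x = x ⊗ x`.) -/
theorem quadric_squares_linearize
    (V₁ V₂ : Type) [AddCommGroup V₁] [Module ℂ V₁] [AddCommGroup V₂] [Module ℂ V₂]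
    [FiniteDimensional ℂ V₁] [FiniteDimensional ℂ V₂]
    (n : ℕ) (hn : 3 ≤ n) (h₁ : finrank ℂ V₁ = n) (h₂ : finrank ℂ V₂ = n)
    (q₁ : QuadraticForm ℂ V₁) (q₂ : QuadraticForm ℂ V₂)
    (hq₁ : ∀ x : V₁, (∀ y : V₁, QuadraticMap.polar q₁ x y = 0) → x = 0)
    (hq₂ : ∀ x : V₂, (∀ y : V₂, QuadraticMap.polar q₂ x y = 0) → x = 0)
    (ξ : (V₁ ⊗[ℂ] V₁) ≃ₗ[ℂ] (V₂ ⊗[ℂ] V₂))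
    (hξ : ∀ x : V₁, q₁ x = 0 →
      ∃ y : V₂, q₂ y = 0 ∧ ∃ c : ℂ, ξ (x ⊗ₜ[ℂ] x) = c • (y ⊗ₜ[ℂ] y)) :
    ∃ φ : V₁ →ₗ[ℂ] V₂,
      φ '' {x : V₁ | q₁ x = 0} = {y : V₂ | q₂ y = 0} ∧
      ∃ c : ℂ, c ≠ 0 ∧ ∀ x : V₁, q₁ x = 0 → ξ (x ⊗ₜ[ℂ] x) = c • (φ x ⊗ₜ[ℂ] φ x) := by
  obtain ⟨m, rfl⟩ := Nat.exists_eq_add_of_le' hn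
  obtain ⟨E, hE⟩ := QuadraticForm.exists_linearEquiv_standard (m := m + 1) h₁ q₁ hq₁
  obtain ⟨ψ, c, hc, hψ⟩ := exists_linearMap_of_standard_quadric m.succ_pos
    (TensorProduct.congr E.symm E.symm ≪≫ₗ ξ).toLinearMap
    (TensorProduct.congr E.symm E.symm ≪≫ₗ ξ).injective fun x hx => by
      obtain ⟨y, -, c, h⟩ := hξ (E.symm x) (by simpa [hE] using hx)
      exact ⟨y, c, by simpa using h⟩
  let φ : V₁ →ₗ[ℂ] V₂ := ψ ∘ₗ E.toLinearMap
  have hφ : ∀ x, q₁ x = 0 → ξ (x ⊗ₜ[ℂ] x) = c • (φ x ⊗ₜ[ℂ] φ x) := fun x hx => by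
    simpa [φ] using hψ (E x) (by rw [← hE, hx])
  have hinj : Function.Injective φ :=
    QuadraticForm.injective_of_isotropic_squares (by omega) q₁ hq₁ φ fun x y hx hy h =>
      ξ.injective (by rw [hφ x hx, hφ y hy, h])
  have hsurj : Function.Surjective φ :=
    (LinearMap.injective_iff_surjective_of_finrank_eq_finrank (h₁.trans h₂.symm)).1 hinj
  have hmaps : ∀ x, q₁ x = 0 → q₂ (φ x) = 0 := fun x hx => by
    obtain ⟨y, hy, d, h⟩ := hξ x hx
    rw [hφ x hx] at h
    have h' := congrArg (TensorProduct.lift q₂.polarBilin) h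
    simpa [QuadraticMap.polar_self, hy, hc] using h'
  obtain ⟨d, hd⟩ := QuadraticForm.exists_eq_mul_of_zeros (by omega) q₁ hq₁ (q₂.comp φ) hmaps
  have hd0 : d ≠ 0 := by
    rintro rfl
    have hzero : ∀ y, q₂ y = 0 := fun y => by
      obtain ⟨x, rfl⟩ := hsurj y
      simpa using hd x
    have : Nontrivial V₂ := Module.nontrivial_of_finrank_pos (R := ℂ) (by omega)
    obtain ⟨y, hy⟩ := exists_ne (0 : V₂)
    exact hy (hq₂ y fun z => by simp [QuadraticMap.polar, hzero])
  refine ⟨φ, Set.Subset.antisymm ?_ fun y hy => ?_, c, hc, hφ⟩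
  · rintro _ ⟨x, hx, rfl⟩
    exact hmaps x hx
  · obtain ⟨x, rfl⟩ := hsurj y
    have := hd x
    rw [QuadraticMap.comp_apply, show q₂ (φ x) = 0 from hy] at this
    exact ⟨x, (mul_eq_zero.1 this.symm).resolve_left hd0, rfl⟩
end
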